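/- arXiv:math/0304489 — 7 statements merged into one kernel-verified Lean document; each statement's English description precedes it below -/
import Mathlib

section
/- Let ξ : ℂ → ℂ be given by ξ(z) = 27z²(z−1)²/(4(z²−z+1)³). For every z ∈ ℂ with z²−z+1 ≠ 0, if the derivative of ξ vanishes at z then ξ(z) ∈ {0,1}; moreover ξ(0) = 0 and ξ(1) = 0. (Thus all finite critical values of the rational function ξ lie in {0,1}, the finite part of the condition that ξ is a Belyi-extending map.) -/
theorem hasDerivAt_xi (z : ℂ) (hz : z ^ 2 - z + 1 ≠ 0) :
    HasDerivAt (fun z : ℂ => 27 * z ^ 2 * (z - 1) ^ 2 / (4 * (z ^ 2 - z + 1) ^ 3))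
      (27 * (z * (z - 1)) * (2 - z) * (z + 1) * (2 * z - 1) / (4 * (z ^ 2 - z + 1) ^ 4)) z := by
  have hid := hasDerivAt_id' z
  have hnum := ((hid.pow 2).const_mul 27).mul ((hid.sub_const 1).pow 2)
  have hden := ((((hid.pow 2).sub hid).add_const 1).pow 3).const_mul 4
  have hne : 4 * (z ^ 2 - z + 1) ^ 3 ≠ 0 := mul_ne_zero (by norm_num) (pow_ne_zero 3 hz)
  refine (hnum.div hden hne).congr_deriv ?_
  simp only [Pi.mul_apply, Pi.pow_apply, Pi.sub_apply]
  rw [div_eq_div_iff (pow_ne_zero 2 hne) (mul_ne_zero (by norm_num) (pow_ne_zero 4 hz))]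
  push_cast
  ring

theorem xi_critical_values :
    (∀ z : ℂ, z ^ 2 - z + 1 ≠ 0 →
        deriv (fun z : ℂ => 27 * z ^ 2 * (z - 1) ^ 2 / (4 * (z ^ 2 - z + 1) ^ 3)) z = 0 →
        27 * z ^ 2 * (z - 1) ^ 2 / (4 * (z ^ 2 - z + 1) ^ 3) ∈ ({0, 1} : Set ℂ)) ∧
      27 * (0 : ℂ) ^ 2 * ((0 : ℂ) - 1) ^ 2 / (4 * ((0 : ℂ) ^ 2 - 0 + 1) ^ 3) = 0 ∧
      27 * (1 : ℂ) ^ 2 * ((1 : ℂ) - 1) ^ 2 / (4 * ((1 : ℂ) ^ 2 - 1 + 1) ^ 3) = 0 := by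
  refine ⟨fun z hz hderiv => ?_, by norm_num, by norm_num⟩
  rw [(hasDerivAt_xi z hz).deriv, div_eq_zero_iff,
    or_iff_left (mul_ne_zero (by norm_num) (pow_ne_zero 4 hz))] at hderiv
  simp only [mul_eq_zero, OfNat.ofNat_ne_zero, false_or] at hderiv
  rw [Set.mem_insert_iff, Set.mem_singleton_iff]
  rcases hderiv with (((h | h) | h) | h) | h
  · left; simp [h]
  · left; simp [h]
  · right
    obtain rfl : z = 2 := by linear_combination -h
    norm_num
  · right
    obtain rfl : z = -1 := by linear_combination h
    norm_num
  · right
    obtain rfl : z = 1 / 2 := by linear_combination h / 2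
    norm_num
end

section
/- Let β₄ : ℂ → ℂ be given by β₄(z) = 27z²(z−1)/(3z−1)³. For every z ∈ ℂ with 3z−1 ≠ 0, if the derivative of β₄ vanishes at z then β₄(z) ∈ {0,1}; moreover β₄(0) = 0 and β₄(1) = 0. (Thus all finite critical values of the rational function β₄ lie in {0,1}, the finite part of the condition that β₄ is a Belyi-extending map.) -/
/-- The derivative of `β₄` away from its pole. -/
theorem hasDerivAt_beta4 {z : ℂ} (hz : 3 * z - 1 ≠ 0) :
    HasDerivAt (fun z : ℂ => 27 * z ^ 2 * (z - 1) / (3 * z - 1) ^ 3)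
      (54 * z / (3 * z - 1) ^ 4) z := by
  have hnum : HasDerivAt (fun z : ℂ => 27 * z ^ 2 * (z - 1))
      (27 * (2 * z) * (z - 1) + 27 * z ^ 2 * 1) z := by
    simpa using (((hasDerivAt_id z).fun_pow 2).const_mul 27).fun_mul ((hasDerivAt_id z).sub_const 1)
  have hden : HasDerivAt (fun z : ℂ => (3 * z - 1) ^ 3) (3 * (3 * z - 1) ^ 2 * 3) z := by
    simpa using (((hasDerivAt_id z).const_mul 3).sub_const 1).fun_pow 3
  refine (hnum.fun_div hden (pow_ne_zero 3 hz)).congr_deriv ?_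
  field_simp
  ring

theorem beta4_critical_values :
    (∀ z : ℂ, 3 * z - 1 ≠ 0 →
        deriv (fun z : ℂ => 27 * z ^ 2 * (z - 1) / (3 * z - 1) ^ 3) z = 0 →
        27 * z ^ 2 * (z - 1) / (3 * z - 1) ^ 3 ∈ ({0, 1} : Set ℂ)) ∧
      27 * (0 : ℂ) ^ 2 * ((0 : ℂ) - 1) / (3 * 0 - 1) ^ 3 = 0 ∧
      27 * (1 : ℂ) ^ 2 * ((1 : ℂ) - 1) / (3 * 1 - 1) ^ 3 = 0 := by
  refine ⟨fun z hz hderiv => ?_, by simp, by simp⟩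
  rw [(hasDerivAt_beta4 hz).deriv] at hderiv
  have hz0 : z = 0 := by simpa [hz] using hderiv
  simp [hz0]
end

section
/- Let β₅ : ℂ → ℂ be given by β₅(z) = z²(z−1)/(z−4/3)³. For every z ∈ ℂ with z ≠ 4/3, if the derivative of β₅ vanishes at z then β₅(z) ∈ {0,1}; moreover β₅(0) = 0 and β₅(1) = 0. (Thus all finite critical values of the rational function β₅ lie in {0,1}, the finite part of the condition that β₅ is a Belyi-extending map.) -/
theorem hasDerivAt_beta5 {z : ℂ} (hz : z ≠ 4 / 3) :
    HasDerivAt (fun z : ℂ => z ^ 2 * (z - 1) / (z - 4 / 3) ^ 3)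
      (z * (8 / 3 - 3 * z) / (z - 4 / 3) ^ 4) z := by
  have hne : z - 4 / 3 ≠ 0 := sub_ne_zero.mpr hz
  have hnum := ((hasDerivAt_id z).pow 2).mul ((hasDerivAt_id z).sub_const 1)
  have hden := ((hasDerivAt_id z).sub_const (4 / 3)).pow 3
  refine (hnum.div hden (pow_ne_zero 3 hne)).congr_deriv ?_
  simp only [id, Pi.pow_apply, Pi.mul_apply]
  rw [div_eq_div_iff (pow_ne_zero 2 (pow_ne_zero 3 hne)) (pow_ne_zero 4 hne)]
  push_cast
  ring

theorem beta5_critical_values :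
    (∀ z : ℂ, z ≠ 4 / 3 →
        deriv (fun z : ℂ => z ^ 2 * (z - 1) / (z - 4 / 3) ^ 3) z = 0 →
        z ^ 2 * (z - 1) / (z - 4 / 3) ^ 3 ∈ ({0, 1} : Set ℂ)) ∧
      (0 : ℂ) ^ 2 * ((0 : ℂ) - 1) / ((0 : ℂ) - 4 / 3) ^ 3 = 0 ∧
      (1 : ℂ) ^ 2 * ((1 : ℂ) - 1) / ((1 : ℂ) - 4 / 3) ^ 3 = 0 := by
  refine ⟨fun z hz hd => ?_, by simp, by simp⟩
  have hne : (z - 4 / 3) ^ 4 ≠ 0 := pow_ne_zero 4 (sub_ne_zero.mpr hz)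
  rw [(hasDerivAt_beta5 hz).deriv, div_eq_zero_iff, or_iff_left hne, mul_eq_zero] at hd
  rcases hd with rfl | h
  · simp
  · obtain rfl : z = 8 / 9 := by linear_combination -h / 3
    right
    norm_num
end

section
/- Let β_T : ℂ → ℂ be given by β_T(z) = z³(z³+8)³/(z⁶−20z³−8)². For every z ∈ ℂ with z⁶−20z³−8 ≠ 0, if the derivative of β_T vanishes at z then β_T(z) ∈ {0,1}; moreover β_T(0) = 0 and β_T(1) = 1. (Thus all finite critical values of the rational function β_T lie in {0,1}, the finite part of the condition that β_T is a Belyi-extending map; β_T is the quotient map of ℙ¹ by the tetrahedral group action.) -/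
/-- The derivative of the tetrahedral quotient map, in factored form. -/
lemma hasDerivAt_betaT {z : ℂ} (hz : z ^ 6 - 20 * z ^ 3 - 8 ≠ 0) :
    HasDerivAt (fun z : ℂ => z ^ 3 * (z ^ 3 + 8) ^ 3 / (z ^ 6 - 20 * z ^ 3 - 8) ^ 2)
      (-192 * (z ^ 2 * (z ^ 3 + 8) ^ 2 * (z ^ 3 - 1) ^ 2) / (z ^ 6 - 20 * z ^ 3 - 8) ^ 3) z := by
  have hnum := (hasDerivAt_pow 3 z).mul (((hasDerivAt_pow 3 z).add_const 8).pow 3)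
  have hden := (((hasDerivAt_pow 6 z).sub ((hasDerivAt_pow 3 z).const_mul 20)).sub_const 8).pow 2
  refine (hnum.div hden (pow_ne_zero 2 hz)).congr_deriv ?_
  simp only [Pi.mul_apply, Pi.pow_apply, Pi.sub_apply]
  rw [div_eq_div_iff (pow_ne_zero 2 (pow_ne_zero 2 hz)) (pow_ne_zero 3 hz)]
  push_cast
  ring

theorem betaT_critical_values :
    (∀ z : ℂ, z ^ 6 - 20 * z ^ 3 - 8 ≠ 0 →
        deriv (fun z : ℂ => z ^ 3 * (z ^ 3 + 8) ^ 3 / (z ^ 6 - 20 * z ^ 3 - 8) ^ 2) z = 0 →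
        z ^ 3 * (z ^ 3 + 8) ^ 3 / (z ^ 6 - 20 * z ^ 3 - 8) ^ 2 ∈ ({0, 1} : Set ℂ)) ∧
      (0 : ℂ) ^ 3 * ((0 : ℂ) ^ 3 + 8) ^ 3 / ((0 : ℂ) ^ 6 - 20 * (0 : ℂ) ^ 3 - 8) ^ 2 = 0 ∧
      (1 : ℂ) ^ 3 * ((1 : ℂ) ^ 3 + 8) ^ 3 / ((1 : ℂ) ^ 6 - 20 * (1 : ℂ) ^ 3 - 8) ^ 2 = 1 := by
  refine ⟨fun z hz hderiv => ?_, by norm_num, by norm_num⟩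
  rw [(hasDerivAt_betaT hz).deriv, div_eq_zero_iff, or_iff_left (pow_ne_zero 3 hz)] at hderiv
  have hcrit : (z = 0 ∨ z ^ 3 + 8 = 0) ∨ z ^ 3 - 1 = 0 := by
    simpa only [mul_eq_zero, pow_eq_zero_iff two_ne_zero, neg_eq_zero, OfNat.ofNat_ne_zero,
      false_or] using hderiv
  rw [Set.mem_insert_iff, Set.mem_singleton_iff]
  rcases hcrit with (h | h) | h
  · left
    simp [h]
  · left
    simp [h]
  · right
    rw [div_eq_one_iff_eq (pow_ne_zero 2 hz)]
    linear_combination 64 * (z ^ 3 - 1) ^ 2 * h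
end

section
/- In the symmetric group on the ten-element set {1,2,…,10}, the subgroup generated by the permutations σ = (1 2 3 4)(5 6 7)(8 9) and τ_Δ = (1 8 4 7)(2 3 10)(5 6) is exactly the alternating group A₁₀; in particular this subgroup is transitive and has cardinality 10!/2 = 1814400. -/
open Equiv Equiv.Perm MulAction
open scoped Pointwise

/-- A transitive group which contains an element fixing `a` and permuting the other points
cyclically is primitive. -/
theorem isPreprimitive_of_pow_transitive_on_compl {M X : Type*} [Group M] [MulAction M X]
    [IsPretransitive M X] {a : X} {h : M} (ha : h • a = a)
    (hcyc : ∀ b c : X, b ≠ a → c ≠ a → ∃ k : ℕ, h ^ k • b = c) :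
    IsPreprimitive M X := by
  refine IsPreprimitive.of_isTrivialBlock_base a fun {B} haB hB => ?_
  by_cases hsub : B.Subsingleton
  · exact Or.inl hsub
  obtain ⟨b, hb, hba⟩ := (Set.not_subsingleton_iff.mp hsub).exists_ne a
  refine Or.inr (Set.eq_univ_of_forall fun c => ?_)
  by_cases hca : c = a
  · exact hca ▸ haB
  obtain ⟨k, rfl⟩ := hcyc b c hba hca
  have hk : h ^ k • a = a := (stabilizer M a).pow_mem (mem_stabilizer_iff.mpr ha) k
  have hB' : h ^ k • B = B := hB.smul_eq_of_mem haB (hk.symm ▸ haB)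
  exact hB' ▸ Set.smul_mem_smul_set hb

/-- The permutation `σ`, on the points `0, …, 9`. -/
def dessinSigma : Perm (Fin 10) := c[0, 1, 2, 3] * c[4, 5, 6] * c[7, 8]

/-- The permutation `τ_Δ`, on the points `0, …, 9`. -/
def dessinTau : Perm (Fin 10) := c[0, 7, 3, 6] * c[1, 2, 9] * c[4, 5]

/-- The monodromy group of `Δ`. -/
def dessinMonodromy : Subgroup (Perm (Fin 10)) := Subgroup.closure {dessinSigma, dessinTau}

theorem dessinSigma_mem : dessinSigma ∈ dessinMonodromy :=
  Subgroup.subset_closure (Set.mem_insert _ _)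

theorem dessinTau_mem : dessinTau ∈ dessinMonodromy :=
  Subgroup.subset_closure (Set.mem_insert_of_mem _ rfl)

/-- An element of the monodromy group that fixes `9` and permutes the other points in a
9-cycle. -/
def dessinNineCycle : Perm (Fin 10) :=
  dessinSigma ^ 2 * dessinTau * dessinSigma * (dessinTau ^ 2)⁻¹

theorem dessinNineCycle_mem : dessinNineCycle ∈ dessinMonodromy :=
  mul_mem (mul_mem (mul_mem (pow_mem dessinSigma_mem 2) dessinTau_mem) dessinSigma_mem)
    (inv_mem (pow_mem dessinTau_mem 2))

theorem dessinNineCycle_eq : dessinNineCycle = c[0, 7, 4, 6, 8, 1, 5, 2, 3] := by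
  decide +kernel

theorem exists_dessinNineCycle_pow_apply_eq :
    ∀ b c : Fin 10, b ≠ 9 → c ≠ 9 → ∃ k : Fin 9, (dessinNineCycle ^ (k : ℕ)) b = c := by
  rw [dessinNineCycle_eq]
  decide +kernel

theorem isThreeCycle_dessinSigma_pow_four : (dessinSigma ^ 4).IsThreeCycle := by
  have h : dessinSigma ^ 4 = swap 4 6 * swap 4 5 := by decide +kernel
  rw [h]
  exact isThreeCycle_swap_mul_swap_same (by decide) (by decide) (by decide)

instance isPretransitive_dessinMonodromy : IsPretransitive dessinMonodromy (Fin 10) := by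
  refine (isPretransitive_iff_base 9).mpr fun c => ?_
  by_cases hc : c = 9
  · exact ⟨1, hc ▸ one_smul _ _⟩
  · obtain ⟨k, hk⟩ := exists_dessinNineCycle_pow_apply_eq (dessinTau 9) c
      (by decide +kernel) hc
    refine ⟨⟨dessinNineCycle ^ (k : ℕ) * dessinTau,
      mul_mem (pow_mem dessinNineCycle_mem k) dessinTau_mem⟩, ?_⟩
    rwa [Subgroup.mk_smul, Perm.smul_def, mul_apply]

theorem isPreprimitive_dessinMonodromy : IsPreprimitive dessinMonodromy (Fin 10) := by
  refine isPreprimitive_of_pow_transitive_on_compl (a := 9)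
    (h := ⟨dessinNineCycle, dessinNineCycle_mem⟩) ?_ fun b c hb hc => ?_
  · show dessinNineCycle 9 = 9
    rw [dessinNineCycle_eq]
    decide
  · obtain ⟨k, hk⟩ := exists_dessinNineCycle_pow_apply_eq b c hb hc
    exact ⟨k, hk⟩

theorem dessinMonodromy_eq_alternatingGroup : dessinMonodromy = alternatingGroup (Fin 10) := by
  apply le_antisymm
  · rw [dessinMonodromy, Subgroup.closure_le]
    rintro g (rfl | rfl) <;> rw [SetLike.mem_coe, mem_alternatingGroup] <;> decide +kernel
  · exact alternatingGroup_le_of_isPreprimitive_of_isThreeCycle_mem isPreprimitive_dessinMonodromy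
      isThreeCycle_dessinSigma_pow_four (pow_mem dessinSigma_mem 4)

/- We model the ten-element set `{1, …, 10}` by `Fin 10`, with `i ∈ {1, …, 10}`
corresponding to `i - 1 : Fin 10`.  Thus `σ = (1 2 3 4)(5 6 7)(8 9)` becomes
`c[0,1,2,3] * c[4,5,6] * c[7,8]` and `τ_Δ = (1 8 4 7)(2 3 10)(5 6)` becomes
`c[0,7,3,6] * c[1,2,9] * c[4,5]`. -/
theorem monodromy_group_Delta_eq_alternating :
    Subgroup.closure
        ({c[(0 : Fin 10), 1, 2, 3] * c[4, 5, 6] * c[7, 8],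
          c[(0 : Fin 10), 7, 3, 6] * c[1, 2, 9] * c[4, 5]} : Set (Equiv.Perm (Fin 10))) =
      alternatingGroup (Fin 10) ∧
    (∀ i j : Fin 10, ∃ g ∈ Subgroup.closure
        ({c[(0 : Fin 10), 1, 2, 3] * c[4, 5, 6] * c[7, 8],
          c[(0 : Fin 10), 7, 3, 6] * c[1, 2, 9] * c[4, 5]} : Set (Equiv.Perm (Fin 10))),
        g i = j) ∧
    Nat.card (Subgroup.closure
        ({c[(0 : Fin 10), 1, 2, 3] * c[4, 5, 6] * c[7, 8],
          c[(0 : Fin 10), 7, 3, 6] * c[1, 2, 9] * c[4, 5]} : Set (Equiv.Perm (Fin 10)))) =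
      1814400 := by
  change dessinMonodromy = alternatingGroup (Fin 10) ∧
    (∀ i j : Fin 10, ∃ g ∈ dessinMonodromy, g i = j) ∧ Nat.card dessinMonodromy = 1814400
  refine ⟨dessinMonodromy_eq_alternatingGroup, fun i j => ?_, ?_⟩
  · obtain ⟨g, hg⟩ := exists_smul_eq dessinMonodromy i j
    exact ⟨g, g.2, hg⟩
  · rw [dessinMonodromy_eq_alternatingGroup, nat_card_alternatingGroup, Nat.card_fin]
    decide
end

section
/- In the symmetric group on the ten-element set {1,2,…,10}, the subgroup generated by the permutations σ = (1 2 3 4)(5 6 7)(8 9) and τ_Ω = (1 3 8 9)(2 10)(4 5 6) is exactly the alternating group A₁₀; in particular this subgroup is transitive and has cardinality 10!/2 = 1814400. -/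
open Equiv MulAction

/-- A permutation group containing a cycle that fixes exactly the point `p`, together with an
element moving `p`, is `2`-transitive. -/
theorem isMultiplyPretransitive_two_of_isCycle_of_fixes_one {α : Type*} {G : Subgroup (Perm α)}
    {c t : Perm α} {p : α} (hc : c.IsCycle) (hcG : c ∈ G) (htG : t ∈ G)
    (hp : ∀ x, c x = x ↔ x = p) (ht : t p ≠ p) :
    IsMultiplyPretransitive G α 2 := by
  have hcyc {x y : α} (hx : x ≠ p) (hy : y ≠ p) : ∃ g ∈ G, g p = p ∧ g x = y := by
    obtain ⟨i, hi⟩ := hc.exists_zpow_eq (mt (hp x).1 hx) (mt (hp y).1 hy)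
    exact ⟨c ^ i, zpow_mem hcG i, Perm.zpow_apply_eq_self_of_apply_eq_self ((hp p).2 rfl) i, hi⟩
  have hmove (x : α) : ∃ g ∈ G, g p = x := by
    by_cases hx : x = p
    · exact ⟨1, one_mem G, hx.symm⟩
    · obtain ⟨g, hg, -, hgx⟩ := hcyc ht hx
      exact ⟨g * t, mul_mem hg htG, hgx⟩
  rw [is_two_pretransitive_iff]
  intro a b x y hab hxy
  obtain ⟨g, hg, rfl⟩ := hmove a
  obtain ⟨h, hh, rfl⟩ := hmove x
  obtain ⟨k, hk, hkp, hkb⟩ := hcyc (x := g⁻¹ b) (y := h⁻¹ y)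
    (fun e ↦ hab (Perm.inv_eq_iff_eq.1 e).symm) (fun e ↦ hxy (Perm.inv_eq_iff_eq.1 e).symm)
  refine ⟨⟨h * k * g⁻¹, mul_mem (mul_mem hh hk) (inv_mem hg)⟩, ?_, ?_⟩
  · simp [Subgroup.smul_def, hkp]
  · change h (k (g⁻¹ b)) = y
    rw [hkb, ← Perm.mul_apply, mul_inv_cancel, Perm.one_apply]

/- We model the ten-element set `{1, …, 10}` by `Fin 10`, with `i ∈ {1, …, 10}`
corresponding to `i - 1 : Fin 10`.  Thus `σ = (1 2 3 4)(5 6 7)(8 9)` becomes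
`c[0,1,2,3] * c[4,5,6] * c[7,8]` and `τ_Ω = (1 3 8 9)(2 10)(4 5 6)` becomes
`c[0,2,7,8] * c[1,9] * c[3,4,5]`. -/
theorem monodromy_group_Omega_eq_alternating :
    Subgroup.closure
        ({c[(0 : Fin 10), 1, 2, 3] * c[4, 5, 6] * c[7, 8],
          c[(0 : Fin 10), 2, 7, 8] * c[1, 9] * c[3, 4, 5]} : Set (Equiv.Perm (Fin 10))) =
      alternatingGroup (Fin 10) ∧
    (∀ i j : Fin 10, ∃ g ∈ Subgroup.closure
        ({c[(0 : Fin 10), 1, 2, 3] * c[4, 5, 6] * c[7, 8],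
          c[(0 : Fin 10), 2, 7, 8] * c[1, 9] * c[3, 4, 5]} : Set (Equiv.Perm (Fin 10))),
        g i = j) ∧
    Nat.card (Subgroup.closure
        ({c[(0 : Fin 10), 1, 2, 3] * c[4, 5, 6] * c[7, 8],
          c[(0 : Fin 10), 2, 7, 8] * c[1, 9] * c[3, 4, 5]} : Set (Equiv.Perm (Fin 10)))) =
      1814400 := by
  set σ : Perm (Fin 10) := c[(0 : Fin 10), 1, 2, 3] * c[4, 5, 6] * c[7, 8]
  set τ : Perm (Fin 10) := c[(0 : Fin 10), 2, 7, 8] * c[1, 9] * c[3, 4, 5]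
  set G := Subgroup.closure ({σ, τ} : Set (Perm (Fin 10)))
  have hσG : σ ∈ G := Subgroup.subset_closure (by simp)
  have hτG : τ ∈ G := Subgroup.subset_closure (by simp)
  have hcycle : σ⁻¹ * σ⁻¹ * τ⁻¹ * σ * τ = c[(0 : Fin 10), 6, 1, 3, 5, 8, 9, 2, 7] := by
    decide +kernel
  have hcG : c[(0 : Fin 10), 6, 1, 3, 5, 8, 9, 2, 7] ∈ G := hcycle ▸
    mul_mem (mul_mem (mul_mem (mul_mem (inv_mem hσG) (inv_mem hσG)) (inv_mem hτG)) hσG) hτG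
  have h2 : IsMultiplyPretransitive G (Fin 10) 2 := by
    refine isMultiplyPretransitive_two_of_isCycle_of_fixes_one (p := 4) ?_ hcG hτG
      (by decide +kernel) (by decide +kernel)
    exact List.isCycle_formPerm (by decide) (by decide)
  have hthree : (σ ^ 4).IsThreeCycle := by
    rw [← card_support_eq_three_iff]
    decide +kernel
  have hG : G = alternatingGroup (Fin 10) := by
    apply le_antisymm
    · rw [Subgroup.closure_le]
      rintro g (rfl | rfl) <;> rw [SetLike.mem_coe, Perm.mem_alternatingGroup] <;> decide +kernel
    · exact Perm.alternatingGroup_le_of_isPreprimitive_of_isThreeCycle_mem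
        (isPreprimitive_of_is_two_pretransitive h2) hthree (pow_mem hσG 4)
  refine ⟨hG, fun i j ↦ ?_, ?_⟩
  · have : IsPretransitive G (Fin 10) := isPretransitive_of_is_two_pretransitive
    obtain ⟨g, hg⟩ := exists_smul_eq G i j
    exact ⟨g, g.2, hg⟩
  · rw [hG, nat_card_alternatingGroup, Nat.card_fin]
    decide +kernel
end

section
/- Let α be a nonempty type and let G be a subgroup of the permutation group Perm(α) whose natural action on α is transitive. Suppose some element σ ∈ G has exactly one fixed point in α. Then every permutation π of α that commutes with every element of G is the identity. (In particular, the automorphism group of a dessin that has a vertex of valency 1 — i.e., whose monodromy permutation σ has a unique fixed point while the monodromy group is transitive — is trivial.) -/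
theorem centralizer_trivial_of_transitive_unique_fixed_point
    {α : Type*} [Nonempty α] (G : Subgroup (Equiv.Perm α))
    (htrans : ∀ i j : α, ∃ g ∈ G, g i = j)
    (σ : Equiv.Perm α) (hσ : σ ∈ G) (hfix : ∃! a : α, σ a = a) :
    ∀ π : Equiv.Perm α, (∀ g ∈ G, π * g = g * π) → π = 1 := by
  intro π hπ
  have comm : ∀ g ∈ G, ∀ x, π (g x) = g (π x) := fun g hg x => DFunLike.congr_fun (hπ g hg) x
  obtain ⟨a, ha, huniq⟩ := hfix
  have hπa : π a = a := huniq (π a) (by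
    change σ (π a) = π a
    rw [← comm σ hσ a, ha])
  ext j
  obtain ⟨g, hg, rfl⟩ := htrans a j
  rw [comm g hg a, hπa, Equiv.Perm.one_apply]
end
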